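/- For every f in the tree product ΠP, each map g: [0, d(f)] → ΠP defined by g(0) = f_∅, g(t) = f restricted to ]0,t[ for t ∉ A_f, and g(t) = (f restricted to ]0,a[) ⊔ C_{(x, h(t−a))} for t in a maximal interval ]a,b[ of A_f on which f is constant with value (x,y), where h is a geodesic from x to y in the corresponding piece, is a geodesic in ΠP from f_∅ to f. Moreover, every geodesic from f_∅ to f arises in this way. -/

import Mathlib

open scoped Classical

/-- The set `Ω`: pairs of (distinct) points coming from one of the spaces `M i`. -/
abbrev PairVal (I : Type*) (M : I → Type*) := Σ i : I, M i × M i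

/-- An element of the tree product `ΠP` of the family of metric spaces `M i`:
a partial function from a dense open subset of `]0, d[` to `Ω`, encoded as an
`Option`-valued function, satisfying conditions (Π₁)–(Π₅). -/
structure TreeProdFun (I : Type*) (M : I → Type*) [∀ i, MetricSpace (M i)] where
  /-- the length of the interval of definition -/
  d : ℝ
  d_nonneg : 0 ≤ d
  /-- the partial function; `none` outside the domain -/
  f : ℝ → Option (PairVal I M)
  /-- (Π₁) the domain is contained in `]0, d[` … -/
  dom_sub : ∀ t : ℝ, (f t).isSome → t ∈ Set.Ioo 0 d
  /-- … it is open … -/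
  dom_open : IsOpen {t : ℝ | (f t).isSome = true}
  /-- … and dense in `]0, d[`. -/
  dom_dense : Set.Ioo 0 d ⊆ closure {t : ℝ | (f t).isSome = true}
  /-- values are pairs of *distinct* points -/
  distinct : ∀ t i (x y : M i), f t = some ⟨i, (x, y)⟩ → x ≠ y
  /-- (Π₂) `f` is locally constant on its domain -/
  locConst : ∀ t : ℝ, (f t).isSome → ∀ᶠ s in nhds t, f s = f t
  /-- (Π₃) on a maximal subinterval of the domain with value `(x,y)`, the length of the
  interval equals `dist x y` -/
  intervalLen : ∀ a b : ℝ, a < b → (∀ t ∈ Set.Ioo a b, (f t).isSome) →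
    ¬ (f a).isSome → ¬ (f b).isSome →
    ∀ t ∈ Set.Ioo a b, ∀ i (x y : M i), f t = some ⟨i, (x, y)⟩ → dist x y = b - a
  /-- (Π₄) no fake exits: no two consecutive values of the form `(x₁,x₂), (x₂,x₃)` -/
  noFakeExit : ∀ a b c : ℝ, a < b → b < c →
    (∀ t ∈ Set.Ioo a b, (f t).isSome) → (∀ t ∈ Set.Ioo b c, (f t).isSome) →
    ¬ (f a).isSome → ¬ (f b).isSome → ¬ (f c).isSome →
    ∀ s ∈ Set.Ioo a b, ∀ t ∈ Set.Ioo b c, ∀ i (x y z w : M i),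
      f s = some ⟨i, (x, y)⟩ → f t = some ⟨i, (z, w)⟩ → y ≠ z
  /-- (Π₅) no backtracking: `f` never coincides on `]p-q, p+q[` with its reflection at `p`
  composed with swapping the components of the values -/
  noBacktrack : ∀ p q : ℝ, 0 < q → Set.Ioo (p - q) (p + q) ⊆ Set.Ioo 0 d →
    ¬ ∀ t ∈ Set.Ioo (p - q) (p + q),
        f t = Option.map (fun v : PairVal I M => ⟨v.1, (v.2.2, v.2.1)⟩) (f (2 * p - t))

variable {I : Type*} {M : I → Type*} [∀ i, MetricSpace (M i)]

/-- The domain `A_f` of an element of the tree product. -/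
def TreeProdFun.dom (f : TreeProdFun I M) : Set ℝ := {t : ℝ | (f.f t).isSome}

/-- The empty function `f_∅`. -/
def emptyTPF (I : Type*) (M : I → Type*) [∀ i, MetricSpace (M i)] : TreeProdFun I M where
  d := 0
  d_nonneg := le_refl 0
  f := fun _ => none
  dom_sub := by intro t h; simp at h
  dom_open := by simp
  dom_dense := by simp
  distinct := by intro t i x y h; cases h
  locConst := by intro t h; simp at h
  intervalLen := by intro a b _ _ _ _ t ht i x y h; cases h
  noFakeExit := by intro a b c _ _ _ _ _ _ _ s hs t ht i x y z w h; cases h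
  noBacktrack := by
    intro p q hq hsub _
    have hp : p ∈ Set.Ioo (p - q) (p + q) := by constructor <;> linarith
    have := hsub hp
    simp at this

/-- The divergence point `div(f,g)`: the supremum of all `s` such that the restrictions of
`f` and `g` to `]0,s[ ∩ A_f` coincide. -/
noncomputable def divPt (f g : TreeProdFun I M) : ℝ :=
  sSup {s : ℝ | 0 ≤ s ∧ s ≤ min f.d g.d ∧
    ∀ t ∈ Set.Ioo (0 : ℝ) s, (f.f t).isSome → f.f t = g.f t}

/-- `afterPt f s` is the right endpoint of the maximal (possibly empty) interval
`]s, a[` contained in the domain of `f`; it equals `s` if there is no such interval. -/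
noncomputable def afterPt (f : TreeProdFun I M) (s : ℝ) : ℝ :=
  sSup {b : ℝ | s ≤ b ∧ b ≤ max s f.d ∧ ∀ t ∈ Set.Ioo s b, (f.f t).isSome}

/-- Distance between the second coordinates of two values in `Ω` (0 if undefined or in
different spaces; only used when the indices agree). -/
noncomputable def optSndDist : Option (PairVal I M) → Option (PairVal I M) → ℝ
  | some ⟨i, (_, y)⟩, some ⟨j, (_, w)⟩ =>
      if h : i = j then dist (cast (congrArg M h) y) w else 0
  | _, _ => 0

/-- The two values are defined and have the same first coordinate (`x_g(f) = x_f(g)`). -/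
def sameStart : Option (PairVal I M) → Option (PairVal I M) → Prop
  | some ⟨i, (x, _)⟩, some ⟨j, (z, _)⟩ => ∃ h : i = j, cast (congrArg M h) x = z
  | _, _ => False

/-- The distance function `D` on the tree product, defined case-wise: in type 1
(both functions continue after the divergence point in the same piece through the same
entrance point) via the exit points, in type 2 via the divergence point. -/
noncomputable def Dtp (f g : TreeProdFun I M) : ℝ :=
  if divPt f g < afterPt f (divPt f g) ∧ divPt f g < afterPt g (divPt f g) ∧
      sameStart (f.f ((divPt f g + afterPt f (divPt f g)) / 2))
        (g.f ((divPt f g + afterPt g (divPt f g)) / 2))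
  then (f.d - afterPt f (divPt f g)) + (g.d - afterPt g (divPt f g)) +
       optSndDist (f.f ((divPt f g + afterPt f (divPt f g)) / 2))
         (g.f ((divPt f g + afterPt g (divPt f g)) / 2))
  else (f.d - divPt f g) + (g.d - divPt f g)

/-- A standard geodesic from `f_∅` to `f` in the tree product, as in the paper:
at parameters outside `A_f` it is the restriction `f|_{]0,t[}`, and on a maximal interval
`]a,b[` of `A_f` with value `(x,y)` it travels along a geodesic `h` from `x` to `y` in the
corresponding piece, i.e. `γ t = f|_{]0,a[} ⊔ C_{(x, h(t-a))}`. -/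
def IsStdGeodesic (f : TreeProdFun I M) (γ : ℝ → TreeProdFun I M) : Prop :=
  γ 0 = emptyTPF I M ∧ γ f.d = f ∧
  (∀ t ∈ Set.Icc (0 : ℝ) f.d, (γ t).d = t) ∧
  (∀ t ∈ Set.Icc (0 : ℝ) f.d, ¬ (f.f t).isSome →
      (γ t).f = fun u => if u < t then f.f u else none) ∧
  ∀ a b : ℝ, 0 ≤ a → a < b → b ≤ f.d →
    (∀ u ∈ Set.Ioo a b, (f.f u).isSome) → ¬ (f.f a).isSome → ¬ (f.f b).isSome →
    ∀ i (x y : M i), (∀ u ∈ Set.Ioo a b, f.f u = some ⟨i, (x, y)⟩) →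
    ∃ h : ℝ → M i, h 0 = x ∧ h (b - a) = y ∧
      (∀ s ∈ Set.Icc (0 : ℝ) (b - a), ∀ s' ∈ Set.Icc (0 : ℝ) (b - a),
        dist (h s) (h s') = |s - s'|) ∧
      ∀ t ∈ Set.Ioo a b, (γ t).f = fun u =>
        if u < t then (if a < u then some ⟨i, (x, h (t - a))⟩ else f.f u) else none

namespace TreeProdFun

lemma eq_none_of_le_zero (f : TreeProdFun I M) {u : ℝ} (hu : u ≤ 0) : f.f u = none := by
  by_contra h
  exact absurd (f.dom_sub u (Option.isSome_iff_ne_none.2 h)).1 (not_lt.2 hu)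

lemma eq_none_of_d_le (f : TreeProdFun I M) {u : ℝ} (hu : f.d ≤ u) : f.f u = none := by
  by_contra h
  exact absurd (f.dom_sub u (Option.isSome_iff_ne_none.2 h)).2 (not_lt.2 hu)

/-- The partial function is constant on every interval contained in its domain. -/
lemma const_on_Ioo (f : TreeProdFun I M) {a b : ℝ} (h : ∀ t ∈ Set.Ioo a b, (f.f t).isSome)
    {s t : ℝ} (hs : s ∈ Set.Ioo a b) (ht : t ∈ Set.Ioo a b) : f.f s = f.f t := by
  let _ : TopologicalSpace (Option (PairVal I M)) := ⊥
  have : DiscreteTopology (Option (PairVal I M)) := ⟨rfl⟩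
  refine isPreconnected_Ioo.constant (f := f.f) (fun u hu => ?_) hs ht
  exact (continuousAt_const.congr ((f.locConst u (h u hu)).mono
    fun _ hs => hs.symm)).continuousWithinAt

/-- Every point of the domain lies in a maximal interval of the domain. -/
lemma exists_component (f : TreeProdFun I M) {u : ℝ} (hu : (f.f u).isSome) :
    ∃ a b : ℝ, a < u ∧ u < b ∧ 0 ≤ a ∧ b ≤ f.d ∧ f.f a = none ∧ f.f b = none ∧
      (∀ t ∈ Set.Ioo a b, f.f t = f.f u) := by
  have hmem := f.dom_sub u hu
  have hcl : IsClosed {t : ℝ | f.f t = none} := by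
    have := f.dom_open.isClosed_compl
    convert this using 1
    ext t
    simp
  have h1 : IsClosed ({t : ℝ | f.f t = none} ∩ Set.Iic u) := hcl.inter isClosed_Iic
  have h2 : IsClosed ({t : ℝ | f.f t = none} ∩ Set.Ici u) := hcl.inter isClosed_Ici
  have hb1 : BddAbove ({t : ℝ | f.f t = none} ∩ Set.Iic u) := ⟨u, fun x hx => hx.2⟩
  have hb2 : BddBelow ({t : ℝ | f.f t = none} ∩ Set.Ici u) := ⟨u, fun x hx => hx.2⟩
  have h0 : (0 : ℝ) ∈ ({t : ℝ | f.f t = none} ∩ Set.Iic u) :=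
    ⟨f.eq_none_of_le_zero le_rfl, hmem.1.le⟩
  have hd : f.d ∈ ({t : ℝ | f.f t = none} ∩ Set.Ici u) :=
    ⟨f.eq_none_of_d_le le_rfl, hmem.2.le⟩
  have ha := h1.csSup_mem ⟨_, h0⟩ hb1
  have hb := h2.csInf_mem ⟨_, hd⟩ hb2
  have ha0 := le_csSup hb1 h0
  have hbd := csInf_le hb2 hd
  set a := sSup ({t : ℝ | f.f t = none} ∩ Set.Iic u) with ha_def
  set b := sInf ({t : ℝ | f.f t = none} ∩ Set.Ici u) with hb_def
  have hau : a < u := lt_of_le_of_ne ha.2 (by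
    rintro h
    have h3 : f.f a = none := ha.1
    rw [h] at h3
    simp [h3] at hu)
  have hub : u < b := lt_of_le_of_ne hb.2 (by
    rintro h
    have h3 : f.f b = none := hb.1
    rw [← h] at h3
    simp [h3] at hu)
  have hsome : ∀ t ∈ Set.Ioo a b, (f.f t).isSome := by
    intro t ht
    by_contra hn
    have hn' : f.f t = none := by simpa using hn
    rcases le_total t u with h | h
    · exact absurd (le_csSup hb1 ⟨hn', h⟩) (not_le.2 ht.1)
    · exact absurd (csInf_le hb2 ⟨hn', h⟩) (not_le.2 ht.2)
  exact ⟨a, b, hau, hub, ha0, hbd, ha.1, hb.1, fun t ht => f.const_on_Ioo hsome ht ⟨hau, hub⟩⟩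

/-- Two maximal intervals carrying the same value have the same length. -/
lemma length_eq_length (f g : TreeProdFun I M) {a b a' b' : ℝ} (hab : a < b) (hab' : a' < b')
    {v : PairVal I M} (hf : ∀ t ∈ Set.Ioo a b, f.f t = some v) (hfa : f.f a = none)
    (hfb : f.f b = none) (hg : ∀ t ∈ Set.Ioo a' b', g.f t = some v) (hga : g.f a' = none)
    (hgb : g.f b' = none) : b - a = b' - a' := by
  obtain ⟨i, x, y⟩ := v
  have hm : (a + b) / 2 ∈ Set.Ioo a b := ⟨by linarith, by linarith⟩
  have hm' : (a' + b') / 2 ∈ Set.Ioo a' b' := ⟨by linarith, by linarith⟩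
  rw [← f.intervalLen a b hab (fun t ht => by simp [hf t ht]) (by simp [hfa]) (by simp [hfb])
      _ hm i x y (hf _ hm),
    ← g.intervalLen a' b' hab' (fun t ht => by simp [hg t ht]) (by simp [hga]) (by simp [hgb])
      _ hm' i x y (hg _ hm')]

/-- If `f` and `g` coincide on `A_f ∩ ]0, s[`, then they coincide on `]-∞, s[`. -/
lemma eq_of_agree (f g : TreeProdFun I M) {s : ℝ} (hs : s ≤ f.d)
    (h : ∀ t ∈ Set.Ioo (0 : ℝ) s, (f.f t).isSome → f.f t = g.f t) {u : ℝ} (hu : u < s) :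
    f.f u = g.f u := by
  rcases le_or_gt u 0 with h0 | h0
  · rw [f.eq_none_of_le_zero h0, g.eq_none_of_le_zero h0]
  by_cases hfu : (f.f u).isSome
  · exact h u ⟨h0, hu⟩ hfu
  have hfu' : f.f u = none := by simpa using hfu
  by_contra hne
  have hgu : (g.f u).isSome := by
    rw [Option.isSome_iff_ne_none, ← hfu']
    exact fun h => hne h.symm
  obtain ⟨a, b, hau, hub, ha0, -, hga, hgb, hg⟩ := g.exists_component hgu
  have hmid : (a + u) / 2 ∈ Set.Ioo 0 f.d := ⟨by linarith, by linarith⟩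
  obtain ⟨t, ht, htA⟩ := mem_closure_iff.1 (f.dom_dense hmid) (Set.Ioo a u) isOpen_Ioo
    ⟨by linarith, by linarith⟩
  obtain ⟨p, q, hpt, htq, hp0, -, hfp, hfq, hf⟩ := f.exists_component htA
  have hqu : q ≤ u := by
    by_contra hlt
    have := hf u ⟨by linarith [ht.2], not_le.1 hlt⟩
    rw [hfu'] at this
    simp [← this] at htA
  have hft : f.f t = g.f t := h t ⟨by linarith [ht.1], by linarith [ht.2]⟩ htA
  have hap : a ≤ p := by
    by_contra hlt
    have haI : a ∈ Set.Ioo p q := ⟨not_le.1 hlt, by linarith [ht.1]⟩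
    have h1 := hf a haI
    have h2 := h a ⟨by linarith [haI.1], by linarith⟩ (by rw [h1]; exact htA)
    rw [h1, hga] at h2
    simp [h2] at htA
  obtain ⟨v, hv⟩ := Option.isSome_iff_exists.1 hgu
  have hgt := hg t ⟨ht.1, by linarith [ht.2]⟩
  have := f.length_eq_length g (by linarith) (by linarith) (v := v)
    (fun w hw => by rw [hf w hw, hft, hgt, hv]) hfp hfq (fun w hw => by rw [hg w hw, hv]) hga hgb
  linarith

/-- If `f` and `g` coincide before `s`, then `s` is not an endpoint for `g` only. -/
lemma eq_none_of_agree (f g : TreeProdFun I M) {s : ℝ} (h : ∀ u < s, f.f u = g.f u)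
    (hg : g.f s = none) : f.f s = none := by
  by_contra hne
  have hfs : (f.f s).isSome := Option.isSome_iff_ne_none.2 hne
  obtain ⟨a, b, has, hsb, ha0, -, hfa, hfb, hf⟩ := f.exists_component hfs
  obtain ⟨v, hv⟩ := Option.isSome_iff_exists.1 hfs
  have := f.length_eq_length g (by linarith) has (v := v)
    (fun w hw => by rw [hf w hw, hv]) hfa hfb
    (fun w hw => by rw [← h w hw.2, hf w ⟨hw.1, by linarith [hw.2]⟩, hv])
    (by rw [← h a has, hfa]) hg
  linarith

end TreeProdFun

section divergence

variable (f g : TreeProdFun I M)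

lemma le_divPt {s : ℝ} (h0 : 0 ≤ s) (hf : s ≤ f.d) (hg : s ≤ g.d)
    (h : ∀ t < s, f.f t = g.f t) : s ≤ divPt f g :=
  le_csSup ⟨min f.d g.d, fun _ hx => hx.2.1⟩ ⟨h0, le_min hf hg, fun _ ht _ => h _ ht.2⟩

lemma divPt_nonneg : 0 ≤ divPt f g :=
  le_divPt f g le_rfl f.d_nonneg g.d_nonneg fun t ht => by
    rw [f.eq_none_of_le_zero ht.le, g.eq_none_of_le_zero ht.le]

lemma divPt_le : divPt f g ≤ min f.d g.d :=
  csSup_le ⟨0, le_rfl, le_min f.d_nonneg g.d_nonneg, fun _ ht => absurd (ht.1.trans ht.2)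
    (lt_irrefl _)⟩ fun _ hx => hx.2.1

lemma eq_of_lt_divPt {u : ℝ} (hu : u < divPt f g) : f.f u = g.f u := by
  have hne : {s : ℝ | 0 ≤ s ∧ s ≤ min f.d g.d ∧
      ∀ t ∈ Set.Ioo (0 : ℝ) s, (f.f t).isSome → f.f t = g.f t}.Nonempty :=
    ⟨0, le_rfl, le_min f.d_nonneg g.d_nonneg, fun t ht => absurd (ht.1.trans ht.2) (lt_irrefl _)⟩
  obtain ⟨s, hs, hus⟩ := exists_lt_of_lt_csSup hne hu
  exact f.eq_of_agree g (hs.2.1.trans (min_le_left _ _)) hs.2.2 hus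

lemma divPt_eq {s : ℝ} (h0 : 0 ≤ s) (hf : s ≤ f.d) (hg : s ≤ g.d)
    (h : ∀ t < s, f.f t = g.f t) (h' : ∀ r > s, ∃ u < r, f.f u ≠ g.f u) : divPt f g = s := by
  refine le_antisymm (not_lt.1 fun hlt => ?_) (le_divPt f g h0 hf hg h)
  obtain ⟨u, hu, hne⟩ := h' _ hlt
  exact hne (eq_of_lt_divPt f g hu)

lemma divPt_comm : divPt f g = divPt g f := by
  have key : ∀ f g : TreeProdFun I M, divPt f g ≤ divPt g f := fun f g =>
    le_divPt g f (divPt_nonneg f g) ((divPt_le f g).trans (min_le_right _ _))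
      ((divPt_le f g).trans (min_le_left _ _)) fun t ht => (eq_of_lt_divPt f g ht).symm
  exact le_antisymm (key f g) (key g f)

lemma afterPt_eq {s b : ℝ} (hsb : s < b) (h : ∀ t ∈ Set.Ioo s b, (f.f t).isSome)
    (hb : f.f b = none) : afterPt f s = b := by
  have hbd : b ≤ f.d := by
    by_contra hlt
    obtain ⟨t, ht1, ht2⟩ := exists_between (max_lt hsb (not_le.1 hlt))
    have := (f.dom_sub t (h t ⟨(le_max_left _ _).trans_lt ht1, ht2⟩)).2
    linarith [le_max_right s f.d]
  have hmem : b ∈ {b : ℝ | s ≤ b ∧ b ≤ max s f.d ∧ ∀ t ∈ Set.Ioo s b, (f.f t).isSome} :=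
    ⟨hsb.le, hbd.trans (le_max_right _ _), h⟩
  refine le_antisymm (csSup_le ⟨b, hmem⟩ fun c hc => ?_)
    (le_csSup ⟨max s f.d, fun _ hx => hx.2.1⟩ hmem)
  by_contra hlt
  have := hc.2.2 b ⟨hsb, not_le.1 hlt⟩
  simp [hb] at this

lemma afterPt_d : afterPt f f.d = f.d := by
  have hmem : f.d ∈ {b : ℝ | f.d ≤ b ∧ b ≤ max f.d f.d ∧
      ∀ t ∈ Set.Ioo f.d b, (f.f t).isSome} := ⟨le_rfl, by simp, by simp⟩
  refine le_antisymm (csSup_le ⟨_, hmem⟩ fun c hc => ?_)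
    (le_csSup ⟨max f.d f.d, fun _ hx => hx.2.1⟩ hmem)
  simpa using hc.2.1

lemma afterPt_spec {s : ℝ} (hs : s < afterPt f s) :
    (∀ t ∈ Set.Ioo s (afterPt f s), (f.f t).isSome) ∧ f.f (afterPt f s) = none ∧
      afterPt f s ≤ f.d := by
  have hne : {b : ℝ | s ≤ b ∧ b ≤ max s f.d ∧ ∀ t ∈ Set.Ioo s b, (f.f t).isSome}.Nonempty :=
    ⟨s, le_rfl, le_max_left _ _, by simp⟩
  have h1 : ∀ t ∈ Set.Ioo s (afterPt f s), (f.f t).isSome := by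
    intro t ht
    obtain ⟨c, hc, htc⟩ := exists_lt_of_lt_csSup hne ht.2
    exact hc.2.2 t ⟨ht.1, htc⟩
  have h2 : f.f (afterPt f s) = none := by
    by_contra hn
    obtain ⟨a, b, ha, hb, -, hbd, -, -, h⟩ :=
      f.exists_component (Option.isSome_iff_ne_none.2 hn)
    have : b ≤ afterPt f s := by
      refine le_csSup ⟨max s f.d, fun _ hx => hx.2.1⟩
        ⟨by linarith, hbd.trans (le_max_right _ _), fun t ht => ?_⟩
      rcases lt_or_ge t (afterPt f s) with hlt | hge
      · exact h1 t ⟨ht.1, hlt⟩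
      · rw [h t ⟨by linarith, ht.2⟩]
        exact Option.isSome_iff_ne_none.2 hn
    linarith
  refine ⟨h1, h2, ?_⟩
  have h3 : afterPt f s ≤ max s f.d := csSup_le hne fun c hc => hc.2.1
  rcases le_max_iff.1 h3 with h | h
  · linarith
  · exact h

end divergence

lemma sameStart_comm {J : Type*} {N : J → Type*} (v w : Option (PairVal J N)) :
    sameStart v w ↔ sameStart w v := by
  rcases v with _ | ⟨i, x, y⟩ <;> rcases w with _ | ⟨j, z, w⟩ <;> simp only [sameStart]
  constructor
  · rintro ⟨rfl, h⟩
    exact ⟨rfl, h.symm⟩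
  · rintro ⟨rfl, h⟩
    exact ⟨rfl, h.symm⟩

lemma optSndDist_comm (v w : Option (PairVal I M)) : optSndDist v w = optSndDist w v := by
  rcases v with _ | ⟨i, x, y⟩ <;> rcases w with _ | ⟨j, z, w⟩ <;> simp only [optSndDist]
  by_cases h : i = j
  · subst h
    simp [dist_comm]
  · rw [dif_neg h, dif_neg (Ne.symm h)]

lemma Dtp_comm (f g : TreeProdFun I M) : Dtp f g = Dtp g f := by
  unfold Dtp
  rw [divPt_comm g f, sameStart_comm, optSndDist_comm]
  congr 1
  · exact propext ⟨fun h => ⟨h.2.1, h.1, h.2.2⟩, fun h => ⟨h.2.1, h.1, h.2.2⟩⟩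
  · ring
  · ring

/-- The distance from a restriction of `f` to `f`. -/
lemma Dtp_of_restrict (g f : TreeProdFun I M) (hd : g.d ≤ f.d)
    (h : ∀ t < g.d, g.f t = f.f t) : Dtp g f = f.d - g.d := by
  have hdiv : divPt g f = g.d :=
    le_antisymm ((divPt_le g f).trans (min_le_left _ _)) (le_divPt g f g.d_nonneg le_rfl hd h)
  unfold Dtp
  rw [if_neg]
  · rw [hdiv]
    ring
  · rw [hdiv, afterPt_d]
    exact fun h => lt_irrefl _ h.1

/-- `g` and `g'` coincide before `a`, and then run through the piece `M i`, from the common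
entrance point `x` to the distinct exit points `y`, `y'`, which they leave at `p`, `q`. -/
structure IsBranching (g g' : TreeProdFun I M) (a p q : ℝ) (i : I) (x y y' : M i) : Prop where
  nonneg : 0 ≤ a
  left_lt : a < p
  right_lt : a < q
  agree : ∀ u < a, g.f u = g'.f u
  left_start : g.f a = none
  right_start : g'.f a = none
  left_eq : ∀ u ∈ Set.Ioo a p, g.f u = some ⟨i, (x, y)⟩
  right_eq : ∀ u ∈ Set.Ioo a q, g'.f u = some ⟨i, (x, y')⟩
  left_exit : g.f p = none
  right_exit : g'.f q = none
  ne : y ≠ y'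

lemma IsBranching.divPt_eq {g g' : TreeProdFun I M} {a p q : ℝ} {i : I} {x y y' : M i}
    (h : IsBranching g g' a p q i x y y') : divPt g g' = a := by
  have hm1 := h.left_lt
  have hm2 := h.right_lt
  have hg := g.dom_sub ((a + p) / 2) (by rw [h.left_eq _ ⟨by linarith, by linarith⟩]; rfl)
  have hg' := g'.dom_sub ((a + q) / 2) (by rw [h.right_eq _ ⟨by linarith, by linarith⟩]; rfl)
  refine _root_.divPt_eq g g' h.nonneg (by linarith [hg.2]) (by linarith [hg'.2]) h.agree ?_
  intro r hr
  obtain ⟨u, hu1, hu2⟩ := exists_between (lt_min hr (lt_min hm1 hm2))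
  obtain ⟨hur, hup⟩ := lt_min_iff.1 hu2
  obtain ⟨hup, huq⟩ := lt_min_iff.1 hup
  refine ⟨u, hur, ?_⟩
  rw [h.left_eq u ⟨hu1, hup⟩, h.right_eq u ⟨hu1, huq⟩]
  simpa using h.ne

lemma IsBranching.Dtp_eq {g g' : TreeProdFun I M} {a p q : ℝ} {i : I} {x y y' : M i}
    (h : IsBranching g g' a p q i x y y') :
    Dtp g g' = (g.d - p) + (g'.d - q) + dist y y' := by
  have hm1 := h.left_lt
  have hm2 := h.right_lt
  have h1 : afterPt g a = p :=
    afterPt_eq g hm1 (fun t ht => by rw [h.left_eq t ht]; rfl) h.left_exit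
  have h2 : afterPt g' a = q :=
    afterPt_eq g' hm2 (fun t ht => by rw [h.right_eq t ht]; rfl) h.right_exit
  unfold Dtp
  rw [h.divPt_eq, h1, h2, h.left_eq _ ⟨by linarith, by linarith⟩,
    h.right_eq _ ⟨by linarith, by linarith⟩, if_pos ⟨hm1, hm2, rfl, rfl⟩]
  simp [optSndDist]

lemma IsBranching.dist_left {g g' : TreeProdFun I M} {a p q : ℝ} {i : I} {x y y' : M i}
    (h : IsBranching g g' a p q i x y y') : dist x y = p - a := by
  have hm1 := h.left_lt
  have hm : (a + p) / 2 ∈ Set.Ioo a p := ⟨by linarith, by linarith⟩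
  exact g.intervalLen a p hm1 (fun t ht => by rw [h.left_eq t ht]; rfl)
    (by simp [h.left_start]) (by simp [h.left_exit]) _ hm i x y (h.left_eq _ hm)

lemma IsBranching.dist_right {g g' : TreeProdFun I M} {a p q : ℝ} {i : I} {x y y' : M i}
    (h : IsBranching g g' a p q i x y y') : dist x y' = q - a := by
  have hm1 := h.right_lt
  have hm : (a + q) / 2 ∈ Set.Ioo a q := ⟨by linarith, by linarith⟩
  exact g'.intervalLen a q hm1 (fun t ht => by rw [h.right_eq t ht]; rfl)
    (by simp [h.right_start]) (by simp [h.right_exit]) _ hm i x y' (h.right_eq _ hm)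

/-- Neither function is defined at the divergence point. -/
lemma eq_none_at_divPt (g f : TreeProdFun I M) :
    g.f (divPt g f) = none ∧ f.f (divPt g f) = none := by
  have hagree : ∀ u < divPt g f, g.f u = f.f u := fun u hu => eq_of_lt_divPt g f hu
  by_cases hgn : g.f (divPt g f) = none
  · exact ⟨hgn, f.eq_none_of_agree g (fun u hu => (hagree u hu).symm) hgn⟩
  by_cases hfn : f.f (divPt g f) = none
  · exact ⟨g.eq_none_of_agree f hagree hfn, hfn⟩
  exfalso
  obtain ⟨a, b, ha, hb, ha0, hbd, -, -, h⟩ :=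
    g.exists_component (Option.isSome_iff_ne_none.2 hgn)
  obtain ⟨a', b', ha', hb', -, hbd', -, -, h'⟩ :=
    f.exists_component (Option.isSome_iff_ne_none.2 hfn)
  obtain ⟨u, hu1, hu2⟩ := exists_between (max_lt ha ha')
  obtain ⟨hua, hua'⟩ := max_lt_iff.1 hu1
  have heq : g.f (divPt g f) = f.f (divPt g f) := by
    rw [← h u ⟨hua, by linarith⟩, ← h' u ⟨hua', by linarith⟩, hagree u hu2]
  have : min b b' ≤ divPt g f := by
    refine le_divPt g f (le_min (by linarith) (by linarith)) ((min_le_left _ _).trans hbd)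
      ((min_le_right _ _).trans hbd') fun t ht => ?_
    rcases lt_or_ge t (divPt g f) with hlt | hge
    · exact hagree t hlt
    · obtain ⟨h1, h2⟩ := lt_min_iff.1 ht
      rw [h t ⟨by linarith, h1⟩, h' t ⟨by linarith, h2⟩, heq]
  exact absurd (lt_min hb hb') (not_lt.2 this)

/-- The two cases in the definition of the distance. -/
lemma Dtp_cases (g f : TreeProdFun I M) :
    Dtp g f = (g.d - divPt g f) + (f.d - divPt g f) ∨
      ∃ (a p q : ℝ) (i : I) (x y y' : M i), IsBranching g f a p q i x y y' ∧
        p ≤ g.d ∧ q ≤ f.d := by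
  by_cases hc : divPt g f < afterPt g (divPt g f) ∧ divPt g f < afterPt f (divPt g f) ∧
      sameStart (g.f ((divPt g f + afterPt g (divPt g f)) / 2))
        (f.f ((divPt g f + afterPt f (divPt g f)) / 2))
  swap
  · left
    unfold Dtp
    rw [if_neg hc]
  right
  obtain ⟨hp, hq, hs⟩ := hc
  obtain ⟨hp1, hp2, hp3⟩ := afterPt_spec g hp
  obtain ⟨hq1, hq2, hq3⟩ := afterPt_spec f hq
  obtain ⟨hn1, hn2⟩ := eq_none_at_divPt g f
  have h0 := divPt_nonneg g f
  have hmax : ∀ s, divPt g f < s → s ≤ g.d → s ≤ f.d → ¬ ∀ t < s, g.f t = f.f t :=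
    fun s h1 h2 h3 h4 => absurd (le_divPt g f (by linarith) h2 h3 h4) (not_le.2 h1)
  have hagree : ∀ u < divPt g f, g.f u = f.f u := fun u hu => eq_of_lt_divPt g f hu
  generalize afterPt g (divPt g f) = p at *
  generalize afterPt f (divPt g f) = q at *
  generalize divPt g f = a at *
  have hmp : (a + p) / 2 ∈ Set.Ioo a p := ⟨by linarith, by linarith⟩
  have hmq : (a + q) / 2 ∈ Set.Ioo a q := ⟨by linarith, by linarith⟩
  obtain ⟨⟨i, x, y⟩, hv⟩ := Option.isSome_iff_exists.1 (hp1 _ hmp)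
  obtain ⟨⟨j, z, w⟩, hw⟩ := Option.isSome_iff_exists.1 (hq1 _ hmq)
  rw [hv, hw] at hs
  obtain ⟨rfl, hxz⟩ := hs
  obtain rfl : x = z := hxz
  have hg : ∀ u ∈ Set.Ioo a p, g.f u = some ⟨i, (x, y)⟩ := fun u hu => by
    rw [g.const_on_Ioo hp1 hu hmp, hv]
  have hf : ∀ u ∈ Set.Ioo a q, f.f u = some ⟨i, (x, w)⟩ := fun u hu => by
    rw [f.const_on_Ioo hq1 hu hmq, hw]
  refine ⟨a, p, q, i, x, y, w, ⟨h0, hp, hq, hagree, hn1, hn2, hg, hf, hp2, hq2, ?_⟩, hp3, hq3⟩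
  rintro rfl
  refine hmax (min p q) (lt_min hp hq) ((min_le_left _ _).trans hp3)
    ((min_le_right _ _).trans hq3) fun t ht => ?_
  obtain ⟨h1, h2⟩ := lt_min_iff.1 ht
  rcases lt_trichotomy t a with h | h | h
  · exact hagree t h
  · rw [h, hn1, hn2]
  · rw [hg t ⟨h, h1⟩, hf t ⟨h, h2⟩]

section standard

variable {f : TreeProdFun I M} {γ : ℝ → TreeProdFun I M}

/-- Before a point outside the domain of `f`, a standard geodesic has already
become equal to `f`. -/
lemma IsStdGeodesic.eq_of_le (hγ : IsStdGeodesic f γ) {t u v : ℝ} (ht : t ∈ Set.Icc 0 f.d)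
    (hu : f.f u = none) (hut : u ≤ t) (hvu : v ≤ u) (hvt : v < t) : (γ t).f v = f.f v := by
  obtain ⟨-, -, -, h1, h2⟩ := hγ
  by_cases hft : (f.f t).isSome
  · obtain ⟨a, b, hat, htb, ha0, hbd, hfa, hfb, h⟩ := f.exists_component hft
    obtain ⟨⟨i, x, y⟩, hv⟩ := Option.isSome_iff_exists.1 hft
    obtain ⟨k, -, -, -, hk⟩ := h2 a b ha0 (hat.trans htb) hbd
      (fun u hu => by rw [h u hu]; exact hft) (by simp [hfa]) (by simp [hfb]) i x y
      (fun u hu => by rw [h u hu, hv])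
    have hua : u ≤ a := by
      by_contra hlt
      have := h u ⟨not_le.1 hlt, by linarith⟩
      rw [hu, hv] at this
      cases this
    rw [hk t ⟨hat, htb⟩]
    simp [hvt, not_lt.2 (hvu.trans hua)]
  · rw [h1 t ht hft]
    simp [hvt]

lemma IsStdGeodesic.Dtp_of_lt (hγ : IsStdGeodesic f γ) {t t' : ℝ} (ht : t ∈ Set.Icc 0 f.d)
    (ht' : t' ∈ Set.Icc 0 f.d) (hlt : t < t') : Dtp (γ t) (γ t') = t' - t := by
  have hγ' := hγ
  obtain ⟨-, -, hd, h1, h2⟩ := hγ'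
  have hdt := hd t ht
  have hdt' := hd t' ht'
  by_cases hft : (f.f t).isSome
  swap
  · have hn : f.f t = none := by simpa using hft
    rw [Dtp_of_restrict _ _ (by linarith), hdt, hdt']
    intro u hu
    rw [hdt] at hu
    rw [hγ.eq_of_le ht hn le_rfl hu.le hu, hγ.eq_of_le ht' hn hlt.le hu.le (hu.trans hlt)]
  obtain ⟨a, b, hat, htb, ha0, hbd, hfa, hfb, h⟩ := f.exists_component hft
  obtain ⟨⟨i, x, y⟩, hv⟩ := Option.isSome_iff_exists.1 hft
  obtain ⟨k, hk0, hk1, hkd, hk⟩ := h2 a b ha0 (hat.trans htb) hbd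
    (fun u hu => by rw [h u hu]; exact hft) (by simp [hfa]) (by simp [hfb]) i x y
    (fun u hu => by rw [h u hu, hv])
  have hleft : ∀ s, s ∈ Set.Ioo a b → ∀ u ∈ Set.Ioo a s,
      (γ s).f u = some ⟨i, (x, k (s - a))⟩ := fun s hs u hu => by
    rw [hk s hs]
    simp [hu.1, hu.2]
  rcases lt_or_ge t' b with htb' | htb'
  · have hdist : dist (k (t - a)) (k (t' - a)) = t' - t := by
      rw [hkd _ ⟨by linarith, by linarith⟩ _ ⟨by linarith, by linarith⟩, abs_sub_comm,
        abs_of_nonneg (by linarith)]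
      ring
    have hb : IsBranching (γ t) (γ t') a t t' i x (k (t - a)) (k (t' - a)) :=
      { nonneg := ha0
        left_lt := hat
        right_lt := hat.trans hlt
        agree := fun u hu => by
          rw [hγ.eq_of_le ht hfa hat.le hu.le (hu.trans hat),
            hγ.eq_of_le ht' hfa (by linarith) hu.le (by linarith)]
        left_start := by rw [hγ.eq_of_le ht hfa hat.le le_rfl hat, hfa]
        right_start := by rw [hγ.eq_of_le ht' hfa (by linarith) le_rfl (by linarith), hfa]
        left_eq := hleft t ⟨hat, htb⟩
        right_eq := hleft t' ⟨by linarith, htb'⟩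
        left_exit := (γ t).eq_none_of_d_le hdt.le
        right_exit := (γ t').eq_none_of_d_le hdt'.le
        ne := dist_pos.1 (by rw [hdist]; linarith) }
    rw [hb.Dtp_eq, hdist, hdt, hdt']
    ring
  · have hdist : dist (k (t - a)) y = b - t := by
      rw [← hk1, hkd _ ⟨by linarith, by linarith⟩ _ ⟨by linarith, by linarith⟩, abs_sub_comm,
        abs_of_nonneg (by linarith)]
      ring
    have hb : IsBranching (γ t) (γ t') a t b i x (k (t - a)) y :=
      { nonneg := ha0
        left_lt := hat
        right_lt := hat.trans htb
        agree := fun u hu => by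
          rw [hγ.eq_of_le ht hfa hat.le hu.le (hu.trans hat),
            hγ.eq_of_le ht' hfa (by linarith) hu.le (by linarith)]
        left_start := by rw [hγ.eq_of_le ht hfa hat.le le_rfl hat, hfa]
        right_start := by rw [hγ.eq_of_le ht' hfa (by linarith) le_rfl (by linarith), hfa]
        left_eq := hleft t ⟨hat, htb⟩
        right_eq := fun u hu => by
          rw [hγ.eq_of_le ht' hfb htb' hu.2.le (by linarith [hu.2]), h u hu, hv]
        left_exit := (γ t).eq_none_of_d_le hdt.le
        right_exit := by
          rcases htb'.lt_or_eq with hlt' | heq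
          · rw [hγ.eq_of_le ht' hfb htb' le_rfl hlt', hfb]
          · exact (γ t').eq_none_of_d_le (by linarith)
        ne := dist_pos.1 (by rw [hdist]; linarith) }
    rw [hb.Dtp_eq, hdist, hdt, hdt']
    ring

end standard

/-- A function on a geodesic between `f_∅` and `f` is a restriction of `f`, or it is
a restriction of `f` continued inside the piece that `f` enters next. -/
lemma restrict_or_branching (g f : TreeProdFun I M) (h : Dtp g f = f.d - g.d) :
    (∀ u < g.d, g.f u = f.f u) ∨ ∃ (a q : ℝ) (i : I) (x z y : M i),
      IsBranching g f a g.d q i x z y ∧ g.d < q ∧ dist z y = q - g.d := by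
  rcases Dtp_cases g f with h2 | ⟨a, p, q, i, x, z, y, hb, hp, hq⟩
  · left
    have : divPt g f = g.d := by linarith
    intro u hu
    exact eq_of_lt_divPt g f (by rwa [this])
  · right
    have h3 := hb.Dtp_eq
    have h4 := hb.dist_left
    have h5 := hb.dist_right
    have h6 := dist_triangle x z y
    obtain rfl : p = g.d := by linarith
    refine ⟨a, q, i, x, z, y, hb, ?_, by linarith⟩
    have := dist_pos.2 hb.ne
    linarith

lemma Dtp_emptyTPF (g : TreeProdFun I M) : Dtp (emptyTPF I M) g = g.d := by
  rw [Dtp_of_restrict (emptyTPF I M) g g.d_nonneg]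
  · simp [emptyTPF]
  · intro t ht
    exact (g.eq_none_of_le_zero (le_of_lt ht)).symm

/-- Inside a maximal interval `]a, b[` with value `(x, y)`, a function between `f_∅` and `f`
is `f` restricted to `]0, a[`, followed by a constant `(x, z)` with `z` between `x` and `y`. -/
lemma exists_between_point (g f : TreeProdFun I M) (h : Dtp g f = f.d - g.d)
    {a b : ℝ} (hab : g.d ∈ Set.Ioo a b) (hfa : f.f a = none) (hfb : f.f b = none)
    {i : I} {x y : M i} (hf : ∀ u ∈ Set.Ioo a b, f.f u = some ⟨i, (x, y)⟩) :
    ∃ z : M i, dist x z = g.d - a ∧ dist z y = b - g.d ∧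
      (∀ u ≤ a, g.f u = f.f u) ∧ ∀ u ∈ Set.Ioo a g.d, g.f u = some ⟨i, (x, z)⟩ := by
  obtain ⟨h1, h2⟩ := hab
  rcases restrict_or_branching g f h with hr | ⟨a', q, j, x', z, y', hb, hq, hdist⟩
  · exfalso
    have := g.length_eq_length f h1 (h1.trans h2)
      (fun u hu => by rw [hr u hu.2, hf u ⟨hu.1, hu.2.trans h2⟩]) (by rw [hr a h1, hfa])
      (g.eq_none_of_d_le le_rfl) hf hfa hfb
    linarith
  · have hlt := hb.left_lt
    have haa : a' = a := by
      rcases lt_trichotomy a' a with hl | hl | hl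
      · have := hb.right_eq a ⟨hl, by linarith⟩
        rw [hfa] at this
        cases this
      · exact hl
      · have := hf a' ⟨hl, by linarith⟩
        rw [hb.right_start] at this
        cases this
    subst haa
    have hqb : q = b := by
      rcases lt_trichotomy q b with hl | hl | hl
      · have := hf q ⟨hb.right_lt, hl⟩
        rw [hb.right_exit] at this
        cases this
      · exact hl
      · have := hb.right_eq b ⟨by linarith, hl⟩
        rw [hfb] at this
        cases this
    subst hqb
    have h3 := hf g.d ⟨h1, h2⟩
    rw [hb.right_eq g.d ⟨h1, h2⟩] at h3
    have h4 : (⟨j, (x', y')⟩ : PairVal I M) = ⟨i, (x, y)⟩ := Option.some.inj h3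
    obtain ⟨rfl, h5⟩ := Sigma.mk.inj h4
    obtain ⟨rfl, rfl⟩ := Prod.mk.inj (eq_of_heq h5)
    refine ⟨z, hb.dist_left, hdist, fun u hu => ?_, hb.left_eq⟩
    rcases hu.lt_or_eq with hl | rfl
    · exact hb.agree u hl
    · rw [hb.left_start, hfa]

/-- A geodesic from `f_∅` to `f` is standard. -/
lemma isStdGeodesic_of_isGeodesic {f : TreeProdFun I M} {γ : ℝ → TreeProdFun I M}
    (h0 : γ 0 = emptyTPF I M) (h1 : γ f.d = f)
    (hγ : ∀ t ∈ Set.Icc (0 : ℝ) f.d, ∀ t' ∈ Set.Icc (0 : ℝ) f.d,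
      Dtp (γ t) (γ t') = |t - t'|) : IsStdGeodesic f γ := by
  have hd : ∀ t ∈ Set.Icc (0 : ℝ) f.d, (γ t).d = t := by
    intro t ht
    have := hγ 0 ⟨le_rfl, f.d_nonneg⟩ t ht
    rw [h0, Dtp_emptyTPF, zero_sub, abs_neg, abs_of_nonneg ht.1] at this
    exact this
  have hD : ∀ t ∈ Set.Icc (0 : ℝ) f.d, Dtp (γ t) f = f.d - (γ t).d := by
    intro t ht
    have := hγ t ht f.d ⟨f.d_nonneg, le_rfl⟩
    rw [h1, abs_sub_comm, abs_of_nonneg (by linarith [ht.2])] at this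
    rw [this, hd t ht]
  refine ⟨h0, h1, hd, ?_, ?_⟩
  · intro t ht hft
    have hdt := hd t ht
    have hagree : ∀ u < t, (γ t).f u = f.f u := by
      rcases restrict_or_branching (γ t) f (hD t ht) with
        hr | ⟨a, q, i, x, z, y, hb, hq, -⟩
      · rwa [hdt] at hr
      · rw [hdt] at hb hq
        exact absurd (by rw [hb.right_eq t ⟨hb.left_lt, hq⟩]; rfl) hft
    funext u
    by_cases hu : u < t
    · rw [if_pos hu, hagree u hu]
    · rw [if_neg hu, (γ t).eq_none_of_d_le (by linarith)]
  · intro a b ha0 hab hbd _ hfa hfb i x y hf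
    have hfa' : f.f a = none := by simpa using hfa
    have hfb' : f.f b = none := by simpa using hfb
    have hxy : dist x y = b - a :=
      f.intervalLen a b hab (fun u hu => by rw [hf u hu]; rfl) hfa hfb ((a + b) / 2)
        ⟨by linarith, by linarith⟩ i x y (hf _ ⟨by linarith, by linarith⟩)
    have hex : ∀ t, ∃ z : M i, t ∈ Set.Ioo a b → dist x z = t - a ∧ dist z y = b - t ∧
        (∀ u ≤ a, (γ t).f u = f.f u) ∧ ∀ u ∈ Set.Ioo a t, (γ t).f u = some ⟨i, (x, z)⟩ := by
      intro t
      by_cases htm : t ∈ Set.Ioo a b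
      · have ht : t ∈ Set.Icc 0 f.d := ⟨by linarith [htm.1], by linarith [htm.2]⟩
        have hdt := hd t ht
        obtain ⟨z, hz⟩ := exists_between_point (γ t) f (hD t ht)
          (by rwa [hdt]) hfa' hfb' hf
        rw [hdt] at hz
        exact ⟨z, fun _ => hz⟩
      · exact ⟨x, fun h => absurd h htm⟩
    choose z hz using hex
    let k : ℝ → M i := fun s => if s ≤ 0 then x else if b - a ≤ s then y else z (s + a)
    have hk0 : k 0 = x := if_pos le_rfl
    have hk1 : k (b - a) = y := by
      simp only [k]
      rw [if_neg (by linarith), if_pos le_rfl]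
    have hk : ∀ s, 0 < s → s < b - a → k s = z (s + a) := by
      intro s hs1 hs2
      simp only [k]
      rw [if_neg (by linarith), if_neg (by linarith)]
    have hzz : ∀ t ∈ Set.Ioo a b, ∀ t' ∈ Set.Ioo a b, t < t' → dist (z t) (z t') = t' - t := by
      intro t ht t' ht' hlt
      obtain ⟨hz1, hz2, hz3, hz4⟩ := hz t ht
      obtain ⟨hz1', hz2', hz3', hz4'⟩ := hz t' ht'
      have hmt : t ∈ Set.Icc 0 f.d := ⟨by linarith [ht.1], by linarith [ht.2]⟩
      have hmt' : t' ∈ Set.Icc 0 f.d := ⟨by linarith [ht'.1], by linarith [ht'.2]⟩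
      have hb : IsBranching (γ t) (γ t') a t t' i x (z t) (z t') :=
        { nonneg := ha0
          left_lt := ht.1
          right_lt := ht'.1
          agree := fun u hu => by rw [hz3 u hu.le, hz3' u hu.le]
          left_start := by rw [hz3 a le_rfl, hfa']
          right_start := by rw [hz3' a le_rfl, hfa']
          left_eq := hz4
          right_eq := hz4'
          left_exit := (γ t).eq_none_of_d_le (hd t hmt).le
          right_exit := (γ t').eq_none_of_d_le (hd t' hmt').le
          ne := by
            intro heq
            rw [heq] at hz1
            linarith }
      have h2 := hb.Dtp_eq
      rw [hγ t hmt t' hmt', hd t hmt, hd t' hmt', abs_sub_comm,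
        abs_of_pos (by linarith)] at h2
      linarith
    have hlt : ∀ s ∈ Set.Icc (0 : ℝ) (b - a), ∀ s' ∈ Set.Icc (0 : ℝ) (b - a), s < s' →
        dist (k s) (k s') = s' - s := by
      intro s hs s' hs' hss
      rcases hs.1.eq_or_lt with rfl | h0s
      · rcases hs'.2.eq_or_lt with rfl | hs1
        · rw [hk0, hk1, hxy, sub_zero]
        · rw [hk0, hk s' hss hs1, (hz (s' + a) ⟨by linarith, by linarith⟩).1]
          ring
      · rcases hs'.2.eq_or_lt with rfl | hs1
        · rw [hk1, hk s h0s hss, (hz (s + a) ⟨by linarith, by linarith⟩).2.1]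
          ring
        · rw [hk s h0s (by linarith), hk s' (by linarith) hs1,
            hzz _ ⟨by linarith, by linarith⟩ _ ⟨by linarith, by linarith⟩ (by linarith)]
          ring
    refine ⟨k, hk0, hk1, ?_, ?_⟩
    · intro s hs s' hs'
      rcases lt_trichotomy s s' with h | rfl | h
      · rw [hlt s hs s' hs' h, abs_sub_comm, abs_of_pos (by linarith)]
      · simp
      · rw [dist_comm, hlt s' hs' s hs h, abs_of_pos (by linarith)]
    · intro t ht
      obtain ⟨-, -, hz3, hz4⟩ := hz t ht
      funext u
      rw [hk (t - a) (by linarith [ht.1]) (by linarith [ht.2]), sub_add_cancel]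
      by_cases hu : u < t
      · rw [if_pos hu]
        by_cases hau : a < u
        · rw [if_pos hau, hz4 u ⟨hau, hu⟩]
        · rw [if_neg hau, hz3 u (not_lt.1 hau)]
      · rw [if_neg hu, (γ t).eq_none_of_d_le]
        rw [hd t ⟨by linarith [ht.1], by linarith [ht.2]⟩]
        exact not_lt.1 hu

/-- every standard function as in Definition 3.7 is a geodesic from `f_∅`
to `f`, and conversely every geodesic from `f_∅` to `f` arises this way. -/
theorem stmt_10 (f : TreeProdFun I M) :
    (∀ γ : ℝ → TreeProdFun I M, IsStdGeodesic f γ →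
      ∀ t ∈ Set.Icc (0 : ℝ) f.d, ∀ t' ∈ Set.Icc (0 : ℝ) f.d, Dtp (γ t) (γ t') = |t - t'|) ∧
    (∀ γ : ℝ → TreeProdFun I M, γ 0 = emptyTPF I M → γ f.d = f →
      (∀ t ∈ Set.Icc (0 : ℝ) f.d, ∀ t' ∈ Set.Icc (0 : ℝ) f.d,
        Dtp (γ t) (γ t') = |t - t'|) →
      IsStdGeodesic f γ) := by
  refine ⟨fun γ hγ t ht t' ht' => ?_, fun γ h0 h1 hγ => isStdGeodesic_of_isGeodesic h0 h1 hγ⟩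
  rcases lt_trichotomy t t' with h | rfl | h
  · rw [hγ.Dtp_of_lt ht ht' h, abs_sub_comm, abs_of_pos (by linarith)]
  · rw [Dtp_of_restrict _ _ le_rfl fun _ _ => rfl]
    simp
  · rw [Dtp_comm, hγ.Dtp_of_lt ht' ht h, abs_of_pos (by linarith)]
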